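/- Let n, k ≥ 1, let 0 < t₁ < ⋯ < t_k, and let μ be the product heat kernel measure on (ℝⁿ)^k. Let f : (ℝⁿ)^k → ℝ be a positive C² function such that f and all of its first and second partial derivatives are bounded. Let φ : [0,∞) → ℝ satisfy φ(0) = 0 and φ(t) = ∫₀ᵗ φ'(s) ds for some square-integrable φ' : [0,∞) → ℝ, and set ‖φ‖² = ∫₀^∞ φ'(s)² ds. Then the following differential Harnack inequality holds: ( Σ_{i,j=1}^k φ(t_i)·φ(t_j)·∫ Σ_{α=1}^n ∂²f/∂y_{i,α}∂y_{j,α}(y) dμ(y) ) / ( ∫ f dμ ) − ‖ Σ_{j=1}^k φ(t_j)·∫ ∇^{(j)}f dμ ‖² / ( ∫ f dμ )² + (n/2)·‖φ‖² ≥ 0. -/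

import Mathlib

open MeasureTheory Real

/-- The heat kernel on `ℝⁿ`, normalized so that the generator is the Laplacian. -/
noncomputable def heatKernel (n : ℕ) (t : ℝ) (x y : EuclideanSpace ℝ (Fin n)) : ℝ :=
  (4 * Real.pi * t) ^ (-(n : ℝ) / 2) * Real.exp (-‖x - y‖ ^ 2 / (4 * t))

/-- For a tuple indexed by `Fin k`, the previous value with the convention that the value at
index `0` is `0`. -/
def prevVal {k : ℕ} {α : Type*} [Zero α] (x : Fin k → α) (j : Fin k) : α :=
  if _ : (j : ℕ) = 0 then 0
  else x ⟨(j : ℕ) - 1, lt_of_le_of_lt (Nat.sub_le _ _) j.isLt⟩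

/-- The density of the product heat kernel measure on `(ℝⁿ)^k`. -/
noncomputable def heatDensity (n k : ℕ) (t : Fin k → ℝ)
    (y : Fin k → EuclideanSpace ℝ (Fin n)) : ℝ :=
  ∏ j : Fin k, heatKernel n (t j - prevVal t j) (prevVal y j) (y j)

/-- The product heat kernel measure `μ` on `(ℝⁿ)^k`. -/
noncomputable def heatMeasure (n k : ℕ) (t : Fin k → ℝ) :
    Measure (Fin k → EuclideanSpace ℝ (Fin n)) :=
  MeasureTheory.volume.withDensity (fun y => ENNReal.ofReal (heatDensity n k t y))

/-- The gradient `∇^{(j)} f (y) ∈ ℝⁿ` of `f : (ℝⁿ)^k → ℝ` with respect to its `j`-th variable. -/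
noncomputable def partialGrad (n k : ℕ) (f : (Fin k → EuclideanSpace ℝ (Fin n)) → ℝ)
    (j : Fin k) (y : Fin k → EuclideanSpace ℝ (Fin n)) : EuclideanSpace ℝ (Fin n) :=
  gradient (fun z => f (Function.update y j z)) (y j)

/-- The mixed second derivative `∇²_{(i)(j)} f(y)(v,w)` of `f : (ℝⁿ)^k → ℝ`, taken in
direction `v` in the `i`-th variable and `w` in the `j`-th variable. -/
noncomputable def partialHess (n k : ℕ) (f : (Fin k → EuclideanSpace ℝ (Fin n)) → ℝ)
    (i j : Fin k) (y : Fin k → EuclideanSpace ℝ (Fin n))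
    (v w : EuclideanSpace ℝ (Fin n)) : ℝ :=
  iteratedFDeriv ℝ 2 f y ![Pi.single i v, Pi.single j w]

/-- An integrated form of the Cauchy–Schwarz inequality under a pointwise bound. -/
lemma sq_integral_le_mul_integral {α : Type*} [MeasurableSpace α] {μ : Measure α}
    {A B u : α → ℝ} (hA : Integrable A μ) (hB : Integrable B μ) (hu : Integrable u μ)
    (hA0 : ∀ x, 0 ≤ A x) (hB0 : ∀ x, 0 ≤ B x) (h : ∀ x, u x ^ 2 ≤ A x * B x) :
    (∫ x, u x ∂μ) ^ 2 ≤ (∫ x, A x ∂μ) * ∫ x, B x ∂μ := by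
  have key : ∀ r : ℝ, 0 ≤ (∫ x, A x ∂μ) * (r * r) + (2 * ∫ x, u x ∂μ) * r + ∫ x, B x ∂μ := by
    intro r
    have heq : (∫ x, (A x * (r * r) + 2 * u x * r + B x) ∂μ)
        = (∫ x, A x ∂μ) * (r * r) + (2 * ∫ x, u x ∂μ) * r + ∫ x, B x ∂μ := by
      have hAu : Integrable (fun x => A x * (r * r) + 2 * u x * r) μ :=
        (hA.mul_const _).add ((hu.const_mul 2).mul_const r)
      rw [integral_add hAu hB, integral_add (hA.mul_const _) ((hu.const_mul 2).mul_const r),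
        integral_mul_const, integral_mul_const, integral_const_mul]
    rw [← heq]
    refine integral_nonneg fun x => ?_
    rcases (hA0 x).eq_or_lt with h0 | h0
    · have hu0 : u x = 0 := by
        have := h x
        rw [← h0, zero_mul] at this
        exact pow_eq_zero_iff two_ne_zero |>.1 (le_antisymm this (sq_nonneg _))
      simpa [← h0, hu0] using hB0 x
    · refine nonneg_of_mul_nonneg_right ?_ h0
      nlinarith [sq_nonneg (A x * r + u x), h x]
  have := discrim_le_zero key
  rw [discrim] at this
  linarith

/-- The second-order condition at `0` expressing that `s ↦ exp (C s² / 4) * g s` is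
midpoint log-convex about `0`. -/
lemma second_order_of_midpoint_logConvex {g g₁ : ℝ → ℝ} {g₂ C : ℝ}
    (hg : ∀ s, HasDerivAt g (g₁ s) s) (hg₁ : HasDerivAt g₁ g₂ 0)
    (h : ∀ s, g 0 ^ 2 ≤ Real.exp (C * s ^ 2 / 2) * (g s * g (-s))) :
    0 ≤ g 0 * g₂ - g₁ 0 ^ 2 + C / 2 * g 0 ^ 2 := by
  by_contra! hneg
  set ε : ℝ := -(g 0 * g₂ - g₁ 0 ^ 2 + C / 2 * g 0 ^ 2) / 2 with hε
  have hεpos : 0 < ε := by linarith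
  set m : ℝ → ℝ := fun s => Real.exp (C * s ^ 2 / 2) * (g s * g (-s)) + ε * s ^ 2 with hm
  have hexp : ∀ s, HasDerivAt (fun s : ℝ => Real.exp (C * s ^ 2 / 2))
      (Real.exp (C * s ^ 2 / 2) * (C * s)) s := by
    intro s
    have h1 : HasDerivAt (fun s : ℝ => C * s ^ 2 / 2) (C * s) s := by
      have := ((hasDerivAt_pow 2 s).const_mul C).div_const 2
      convert! this using 1
      norm_num; ring
    exact h1.exp
  have hsq : ∀ s, HasDerivAt (fun s : ℝ => ε * s ^ 2) (2 * ε * s) s := by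
    intro s
    have := (hasDerivAt_pow 2 s).const_mul ε
    convert! this using 1
    norm_num; ring
  have hgneg : ∀ s, HasDerivAt (fun s => g (-s)) (-g₁ (-s)) s := by
    intro s
    have := (hg (-s)).comp s (hasDerivAt_neg s)
    convert! this using 1
    ring
  have hm' : ∀ s, HasDerivAt m (Real.exp (C * s ^ 2 / 2) * (C * s) * (g s * g (-s))
      + Real.exp (C * s ^ 2 / 2) * (g₁ s * g (-s) + g s * -g₁ (-s)) + 2 * ε * s) s := fun s =>
    ((hexp s).mul ((hg s).mul (hgneg s))).add (hsq s)
  have hderiv : deriv m = fun s => Real.exp (C * s ^ 2 / 2) * (C * s) * (g s * g (-s))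
      + Real.exp (C * s ^ 2 / 2) * (g₁ s * g (-s) + g s * -g₁ (-s)) + 2 * ε * s :=
    funext fun s => (hm' s).deriv
  have hg₁neg : HasDerivAt (fun s => -g₁ (-s)) g₂ 0 := by
    have hg₁' : HasDerivAt g₁ g₂ (-0) := by simpa using hg₁
    have := (hg₁'.comp (0 : ℝ) (hasDerivAt_neg (0 : ℝ))).neg
    convert! this using 1
    ring
  have hm'' : HasDerivAt (deriv m) (2 * (g 0 * g₂ - g₁ 0 ^ 2 + C / 2 * g 0 ^ 2) + 2 * ε) 0 := by
    rw [hderiv]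
    have h1 := (((hexp 0).mul ((hasDerivAt_id (0 : ℝ)).const_mul C)).mul
      ((hg 0).mul (hgneg 0))).add ((hexp 0).mul ((hg₁.mul (hgneg 0)).add ((hg 0).mul hg₁neg)))
    have h2 := h1.add ((hasDerivAt_id (0 : ℝ)).const_mul (2 * ε))
    convert! h2 using 1
    simp
    ring
  have hmax : IsLocalMax m 0 := by
    refine isLocalMax_of_deriv_deriv_neg ?_ ?_ (hm' 0).continuousAt
    · rw [hm''.deriv]; linarith
    · rw [hderiv]; simp; ring
  obtain ⟨δ, hδ, hball⟩ := Metric.eventually_nhds_iff.1 hmax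
  have h1 := hball (y := δ / 2) (by rw [Real.dist_eq, sub_zero, abs_of_pos] <;> linarith)
  have h2 := h (δ / 2)
  have h3 : m 0 = g 0 ^ 2 := by simp [hm]; ring
  rw [h3] at h1
  have h4 : 0 < ε * (δ / 2) ^ 2 := by positivity
  simp only [hm] at h1
  linarith

/-- Differentiation under the integral sign along a line. -/
lemma hasDerivAt_integral_translate {E : Type*} [NormedAddCommGroup E] [NormedSpace ℝ E]
    [MeasurableSpace E] [BorelSpace E] [SecondCountableTopology E] {μ : Measure E}
    [IsFiniteMeasure μ] {h : E → ℝ} (hh : ContDiff ℝ 1 h) {A B : ℝ} (hA : ∀ y, |h y| ≤ A)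
    (hB : ∀ y, ‖fderiv ℝ h y‖ ≤ B) (w : E) (s : ℝ) :
    HasDerivAt (fun s : ℝ => ∫ y, h (y + s • w) ∂μ) (∫ y, fderiv ℝ h (y + s • w) w ∂μ) s := by
  have hcont : Continuous (fderiv ℝ h) := hh.continuous_fderiv one_ne_zero
  have hhc := hh.continuous
  refine (hasDerivAt_integral_of_dominated_loc_of_deriv_le (s := Set.univ)
    (F := fun (s : ℝ) y => h (y + s • w)) (F' := fun (s : ℝ) y => fderiv ℝ h (y + s • w) w)
    (bound := fun _ => B * ‖w‖) Filter.univ_mem ?_ ?_ ?_ ?_ ?_ ?_).2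
  · exact Filter.Eventually.of_forall fun s =>
      (by fun_prop : Continuous fun y => h (y + s • w)).aestronglyMeasurable
  · exact Integrable.of_bound
      (by fun_prop : Continuous fun y => h (y + s • w)).aestronglyMeasurable A
      (Filter.Eventually.of_forall fun y => hA _)
  · exact (by fun_prop : Continuous fun y => fderiv ℝ h (y + s • w) w).aestronglyMeasurable
  · exact Filter.Eventually.of_forall fun y s _ =>
      ((fderiv ℝ h (y + s • w)).le_opNorm w).trans
        (mul_le_mul_of_nonneg_right (hB _) (norm_nonneg _))
  · exact integrable_const _
  · refine Filter.Eventually.of_forall fun y s _ => ?_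
    have h1 : HasDerivAt (fun s : ℝ => y + s • w) w s := by
      simpa using ((hasDerivAt_id s).smul_const w).const_add y
    exact ((hh.differentiable one_ne_zero _).hasFDerivAt).comp_hasDerivAt s h1

/-- A one-directional Harnack inequality for a density satisfying a Gaussian identity along the
direction `w`. -/
lemma directional_harnack {E : Type*} [NormedAddCommGroup E] [NormedSpace ℝ E]
    [MeasurableSpace E] [BorelSpace E] [SecondCountableTopology E] {ν : Measure E}
    [ν.IsAddRightInvariant] {ρ : E → ℝ} (hρc : Continuous ρ) (hρ0 : ∀ y, 0 ≤ ρ y)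
    (hρi : Integrable ρ ν) {w : E} {C : ℝ}
    (hρw : ∀ (y : E) (s : ℝ), ρ y ^ 2 = Real.exp (C * s ^ 2 / 2) *
      (ρ (y - s • w) * ρ (y + s • w)))
    {f : E → ℝ} (hf : ContDiff ℝ 2 f) (hf0 : ∀ y, 0 ≤ f y) {M : ℝ}
    (hbd : ∀ y, |f y| ≤ M ∧ ‖fderiv ℝ f y‖ ≤ M ∧ ‖iteratedFDeriv ℝ 2 f y‖ ≤ M) :
    let μ := ν.withDensity fun y => ENNReal.ofReal (ρ y)
    0 ≤ (∫ y, f y ∂μ) * (∫ y, iteratedFDeriv ℝ 2 f y ![w, w] ∂μ)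
      - (∫ y, fderiv ℝ f y w ∂μ) ^ 2 + C / 2 * (∫ y, f y ∂μ) ^ 2 := by
  intro μ
  have : IsFiniteMeasure μ := isFiniteMeasure_withDensity_ofReal hρi.2
  have hf' : ContDiff ℝ 1 (fderiv ℝ f) := hf.fderiv_right (by norm_num)
  have hfw : ContDiff ℝ 1 (fun y => fderiv ℝ f y w) := hf'.clm_apply contDiff_const
  have hfd : ∀ y, fderiv ℝ (fun y => fderiv ℝ f y w) y
      = (ContinuousLinearMap.apply ℝ ℝ w).comp (fderiv ℝ (fderiv ℝ f) y) := fun y =>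
    ((ContinuousLinearMap.apply ℝ ℝ w).hasFDerivAt.comp y
      (hf'.differentiable one_ne_zero y).hasFDerivAt).fderiv
  have hnorm : ∀ y, ‖fderiv ℝ (fderiv ℝ f) y‖ ≤ M := by
    intro y
    rw [← norm_iteratedFDeriv_one, norm_iteratedFDeriv_fderiv]
    exact (hbd y).2.2
  have hd1 := fun s => hasDerivAt_integral_translate (μ := μ) (hf.of_le (by norm_num))
    (fun y => (hbd y).1) (fun y => (hbd y).2.1) w s
  have hd2 := hasDerivAt_integral_translate (μ := μ) hfw (A := M * ‖w‖)
    (B := ‖ContinuousLinearMap.apply ℝ ℝ w‖ * M)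
    (fun y => ((fderiv ℝ f y).le_opNorm w).trans
      (mul_le_mul_of_nonneg_right (hbd y).2.1 (norm_nonneg _)))
    (fun y => by
      rw [hfd]
      exact (ContinuousLinearMap.opNorm_comp_le _ _).trans
        (mul_le_mul_of_nonneg_left (hnorm y) (norm_nonneg _))) w 0
  have hshift : ∀ s : ℝ, ∫ y, f (y + s • w) ∂μ = ∫ y, ρ (y - s • w) * f y ∂ν := by
    intro s
    rw [integral_withDensity_eq_integral_toReal_smul (by fun_prop) (by simp),
      ← integral_sub_right_eq_self _ (s • w)]
    simp [ENNReal.toReal_ofReal (hρ0 _)]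
  have hint : ∀ s : ℝ, Integrable (fun y => ρ (y - s • w) * f y) ν := fun s =>
    (hρi.comp_sub_right (s • w)).mul_bdd (c := M) hf.continuous.aestronglyMeasurable
      (Filter.Eventually.of_forall fun y => (hbd y).1)
  have key := second_order_of_midpoint_logConvex (C := C) hd1 hd2 (fun s => by
    rw [hshift, hshift, hshift]
    have h1 := sq_integral_le_mul_integral
      ((hint s).const_mul (Real.exp (C * s ^ 2 / 2))) (hint (-s)) (hint 0)
      (fun y => mul_nonneg (Real.exp_nonneg _) (mul_nonneg (hρ0 _) (hf0 _)))
      (fun y => mul_nonneg (hρ0 _) (hf0 _))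
      (fun y => le_of_eq <| by
        have := hρw y s
        simp only [zero_smul, sub_zero, neg_smul, sub_neg_eq_add, mul_pow]
        rw [this]; ring)
    rw [integral_const_mul, mul_assoc] at h1
    exact h1)
  simp only [zero_smul, add_zero, hfd] at key
  simpa [iteratedFDeriv_two_apply] using key

lemma prevVal_zero {k : ℕ} {α : Type*} [Zero α] (x : Fin k → α) {j : Fin k} (hj : (j : ℕ) = 0) :
    prevVal x j = 0 := dif_pos hj

lemma prevVal_of_ne_zero {k : ℕ} {α : Type*} [Zero α] (x : Fin k → α) {j : Fin k}
    (hj : (j : ℕ) ≠ 0) :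
    prevVal x j = x ⟨(j : ℕ) - 1, lt_of_le_of_lt (Nat.sub_le _ _) j.isLt⟩ := dif_neg hj

lemma map_prevVal {k : ℕ} {α β : Type*} [Zero α] [Zero β] {g : α → β} (hg : g 0 = 0)
    (x : Fin k → α) (j : Fin k) : g (prevVal x j) = prevVal (fun i => g (x i)) j := by
  unfold prevVal; split_ifs <;> simp [hg]

lemma prevVal_add {k : ℕ} {α : Type*} [AddZeroClass α] (x y : Fin k → α) (j : Fin k) :
    prevVal (x + y) j = prevVal x j + prevVal y j := by
  unfold prevVal; split_ifs <;> simp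

lemma prevVal_sub {k : ℕ} {α : Type*} [AddGroup α] (x y : Fin k → α) (j : Fin k) :
    prevVal (x - y) j = prevVal x j - prevVal y j := by
  unfold prevVal; split_ifs <;> simp

lemma continuous_prevVal {k : ℕ} {α : Type*} [Zero α] [TopologicalSpace α] (j : Fin k) :
    Continuous fun x : Fin k → α => prevVal x j := by
  unfold prevVal; split_ifs <;> fun_prop

lemma prevVal_lt {k : ℕ} {t : Fin k → ℝ} (hmono : StrictMono t) (hpos : ∀ j, 0 < t j)
    (j : Fin k) : prevVal t j < t j := by
  by_cases hj : (j : ℕ) = 0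
  · rw [prevVal_zero t hj]; exact hpos j
  · rw [prevVal_of_ne_zero t hj]; exact hmono (Fin.lt_def.2 (by simp; omega))

lemma prevVal_nonneg {k : ℕ} {t : Fin k → ℝ} (hpos : ∀ j, 0 < t j) (j : Fin k) :
    0 ≤ prevVal t j := by
  unfold prevVal; split_ifs
  exacts [le_rfl, (hpos _).le]

lemma le_prevVal_of_lt {k : ℕ} {t : Fin k → ℝ} (hmono : StrictMono t) {i j : Fin k}
    (hij : i < j) : t i ≤ prevVal t j := by
  have hj : (j : ℕ) ≠ 0 := by have := Fin.lt_def.1 hij; omega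
  rw [prevVal_of_ne_zero t hj]
  exact hmono.monotone (Fin.le_def.2 (by have := Fin.lt_def.1 hij; simp; omega))

/-- Uniformly bounded increments bound the size of every entry of a tuple. -/
lemma norm_le_of_norm_sub_prevVal_le {k : ℕ} {V : Type*} [NormedAddCommGroup V] {y : Fin k → V}
    {S : ℝ} (hS : ∀ j, ‖y j - prevVal y j‖ ≤ S) (j : Fin k) : ‖y j‖ ≤ k * S := by
  have key : ∀ (m : ℕ) (hm : m < k), ‖y ⟨m, hm⟩‖ ≤ (m + 1) * S := by
    intro m
    induction m with
    | zero => intro hm; simpa [prevVal_zero y (j := ⟨0, hm⟩) rfl] using hS ⟨0, hm⟩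
    | succ m ih =>
      intro hm
      have h1 := hS ⟨m + 1, hm⟩
      rw [prevVal_of_ne_zero y (by simp)] at h1
      have h2 := norm_le_norm_add_norm_sub' (y ⟨m + 1, hm⟩) (y ⟨m, by omega⟩)
      have h3 := ih (by omega)
      simp only [Nat.add_sub_cancel] at h1
      push_cast
      linarith
  have hS0 : 0 ≤ S := (norm_nonneg _).trans (hS j)
  refine (key j j.isLt).trans (mul_le_mul_of_nonneg_right ?_ hS0)
  exact_mod_cast j.isLt

lemma heatKernel_nonneg (n : ℕ) {t : ℝ} (ht : 0 ≤ t) (x y : EuclideanSpace ℝ (Fin n)) :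
    0 ≤ heatKernel n t x y :=
  mul_nonneg (Real.rpow_nonneg (by positivity) _) (Real.exp_nonneg _)

/-- The parallelogram identity for the heat kernel. -/
lemma heatKernel_sq (n : ℕ) (τ : ℝ) (a b c d : EuclideanSpace ℝ (Fin n)) :
    heatKernel n τ a c ^ 2 = Real.exp (‖d - b‖ ^ 2 / (2 * τ)) *
      (heatKernel n τ (a - b) (c - d) * heatKernel n τ (a + b) (c + d)) := by
  have hpar := parallelogram_law_with_norm ℝ (a - c) (b - d)
  have h1 : a - b - (c - d) = a - c - (b - d) := by abel
  have h2 : a + b - (c + d) = a - c + (b - d) := by abel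
  have hexp : Real.exp (-‖a - c‖ ^ 2 / (4 * τ)) ^ 2 = Real.exp (‖d - b‖ ^ 2 / (2 * τ)) *
      (Real.exp (-‖a - c - (b - d)‖ ^ 2 / (4 * τ)) *
        Real.exp (-‖a - c + (b - d)‖ ^ 2 / (4 * τ))) := by
    rw [sq, ← Real.exp_add, ← Real.exp_add, ← Real.exp_add, norm_sub_rev d b]
    congr 1
    have : ‖b - d‖ ^ 2 / (2 * τ) = 2 * ‖b - d‖ ^ 2 / (4 * τ) := by
      rw [show 4 * τ = 2 * (2 * τ) by ring, mul_div_mul_left _ _ two_ne_zero]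
    rw [this, ← add_div, ← add_div, ← add_div]
    congr 1
    linarith
  unfold heatKernel
  rw [h1, h2, mul_pow, hexp]
  ring

lemma continuous_heatDensity (n k : ℕ) (t : Fin k → ℝ) : Continuous (heatDensity n k t) := by
  unfold heatDensity heatKernel
  have := fun j : Fin k => continuous_prevVal (α := EuclideanSpace ℝ (Fin n)) j
  fun_prop

lemma heatDensity_nonneg {n k : ℕ} {t : Fin k → ℝ} (ht : ∀ j, prevVal t j < t j)
    (y : Fin k → EuclideanSpace ℝ (Fin n)) : 0 ≤ heatDensity n k t y :=
  Finset.prod_nonneg fun j _ => heatKernel_nonneg n (sub_nonneg.2 (ht j).le) _ _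

lemma heatDensity_sq {n k : ℕ} (t : Fin k → ℝ) (a : Fin k → ℝ) {e : EuclideanSpace ℝ (Fin n)}
    (he : ‖e‖ = 1) (y : Fin k → EuclideanSpace ℝ (Fin n)) (s : ℝ) :
    heatDensity n k t y ^ 2 =
      Real.exp ((∑ j, (a j - prevVal a j) ^ 2 / (t j - prevVal t j)) * s ^ 2 / 2) *
      (heatDensity n k t (y - s • fun j => a j • e) *
        heatDensity n k t (y + s • fun j => a j • e)) := by
  unfold heatDensity
  rw [Finset.sum_mul, Finset.sum_div, Real.exp_sum, ← Finset.prod_mul_distrib,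
    ← Finset.prod_mul_distrib, ← Finset.prod_pow]
  refine Finset.prod_congr rfl fun j _ => ?_
  have hprev : prevVal (s • fun j => a j • e) j = s • prevVal a j • e :=
    (map_prevVal (g := fun r : ℝ => s • r • e) (by simp) a j).symm
  rw [prevVal_sub, prevVal_add, hprev, heatKernel_sq n _ _ (s • prevVal a j • e) _ (s • a j • e)]
  have : ‖s • a j • e - s • prevVal a j • e‖ ^ 2 / (2 * (t j - prevVal t j))
      = (a j - prevVal a j) ^ 2 / (t j - prevVal t j) * s ^ 2 / 2 := by
    rw [← smul_sub, ← sub_smul, norm_smul, norm_smul, he, mul_one, mul_pow, Real.norm_eq_abs,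
      Real.norm_eq_abs, sq_abs, sq_abs, mul_comm 2, ← div_div]
    ring
  rw [this]
  rfl

lemma integrable_exp_neg_mul_norm_sq {V : Type*} [NormedAddCommGroup V] [InnerProductSpace ℝ V]
    [FiniteDimensional ℝ V] [MeasurableSpace V] [BorelSpace V] {c : ℝ} (hc : 0 < c) :
    Integrable fun v : V => Real.exp (-(c * ‖v‖ ^ 2)) := by
  have := (GaussianFourier.integrable_cexp_neg_mul_sq_norm_add (V := V) (b := c)
    (by simpa using hc) 0 0).norm
  simpa [Complex.norm_exp, ← Complex.ofReal_pow] using this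

lemma integrable_heatDensity (n : ℕ) {k : ℕ} {t : Fin k → ℝ} (ht : ∀ j, prevVal t j < t j) :
    Integrable (heatDensity n k t) := by
  have hτ : ∀ j, 0 < 4 * (t j - prevVal t j) := fun j => by linarith [ht j]
  set T : ℝ := ∑ j, 4 * (t j - prevVal t j) + 1
  have hTpos : 0 < T := by
    have := Finset.sum_nonneg fun j (_ : j ∈ Finset.univ) => (hτ j).le
    linarith
  have hτT : ∀ j, 4 * (t j - prevVal t j) ≤ T := fun j => by
    have := Finset.single_le_sum (fun j _ => (hτ j).le) (Finset.mem_univ j)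
    linarith
  set c : ℝ := ((k + 1) ^ 3 * T)⁻¹ with hc
  have hcpos : 0 < c := by positivity
  set K : ℝ := ∏ j, (4 * Real.pi * (t j - prevVal t j)) ^ (-(n : ℝ) / 2) with hK
  have hK0 : 0 ≤ K := Finset.prod_nonneg fun j _ =>
    Real.rpow_nonneg (by nlinarith [hτ j, Real.pi_pos]) _
  have hcoer : ∀ y : Fin k → EuclideanSpace ℝ (Fin n), ∑ j, c * ‖y j‖ ^ 2 ≤
      ∑ j, ‖prevVal y j - y j‖ ^ 2 / (4 * (t j - prevVal t j)) := by
    intro y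
    set D := ∑ j, ‖prevVal y j - y j‖ ^ 2 / (4 * (t j - prevVal t j)) with hD
    have hterm : ∀ j, 0 ≤ ‖prevVal y j - y j‖ ^ 2 / (4 * (t j - prevVal t j)) := fun j =>
      div_nonneg (sq_nonneg _) (hτ j).le
    have hD0 : 0 ≤ D := Finset.sum_nonneg fun j _ => hterm j
    have hincr : ∀ j, ‖y j - prevVal y j‖ ≤ √(T * D) := by
      intro j
      refine Real.le_sqrt_of_sq_le ?_
      have h1 := Finset.single_le_sum (fun j _ => hterm j) (Finset.mem_univ j)
      rw [← hD, div_le_iff₀ (hτ j), norm_sub_rev] at h1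
      nlinarith [hτT j]
    have hy : ∀ j, c * ‖y j‖ ^ 2 ≤ D / (k + 1) := by
      intro j
      have h1 := pow_le_pow_left₀ (norm_nonneg _) (norm_le_of_norm_sub_prevVal_le hincr j) 2
      rw [mul_pow, Real.sq_sqrt (by positivity)] at h1
      calc c * ‖y j‖ ^ 2 ≤ c * ((k + 1) ^ 2 * (T * D)) := by
            gcongr
            refine h1.trans ?_
            gcongr
            linarith
        _ = D / (k + 1) := by rw [hc]; field_simp
    calc ∑ j, c * ‖y j‖ ^ 2 ≤ ∑ _j : Fin k, D / (k + 1) := Finset.sum_le_sum fun j _ => hy j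
      _ = k / (k + 1) * D := by simp; ring
      _ ≤ D := mul_le_of_le_one_left hD0 (by rw [div_le_one (by positivity)]; linarith)
  have hdom : Integrable fun y : Fin k → EuclideanSpace ℝ (Fin n) =>
      K * ∏ j, Real.exp (-(c * ‖y j‖ ^ 2)) :=
    (Integrable.fintype_prod fun _ => integrable_exp_neg_mul_norm_sq hcpos).const_mul K
  refine hdom.mono' (continuous_heatDensity n k t).aestronglyMeasurable
    (Filter.Eventually.of_forall fun y => ?_)
  rw [Real.norm_of_nonneg (heatDensity_nonneg ht y)]
  unfold heatDensity heatKernel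
  rw [Finset.prod_mul_distrib, ← Real.exp_sum, ← Real.exp_sum, ← hK]
  refine mul_le_mul_of_nonneg_left (Real.exp_le_exp.2 ?_) hK0
  simpa [neg_div, Finset.sum_neg_distrib] using hcoer y

/-- The discrete energy of a path along a partition is bounded by its Dirichlet energy. -/
lemma sum_sq_increments_le {k : ℕ} {t : Fin k → ℝ} (hmono : StrictMono t) (hpos : ∀ j, 0 < t j)
    {φ φ' : ℝ → ℝ} (hφ'meas : Measurable φ')
    (hφ'L2 : IntegrableOn (fun s => φ' s ^ 2) (Set.Ioi (0 : ℝ)))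
    (hφrep : ∀ s ≥ (0 : ℝ), φ s = ∫ r in Set.Ioc (0 : ℝ) s, φ' r) :
    ∑ j, (φ (t j) - prevVal (fun i => φ (t i)) j) ^ 2 / (t j - prevVal t j) ≤
      ∫ s in Set.Ioi (0 : ℝ), φ' s ^ 2 := by
  have hφ0 : φ 0 = 0 := by simp [hφrep 0 le_rfl]
  have hsub : ∀ j, Set.Ioc (prevVal t j) (t j) ⊆ Set.Ioi 0 := fun j x hx =>
    (prevVal_nonneg hpos j).trans_lt hx.1
  have hint : ∀ a b : ℝ, 0 ≤ a → IntegrableOn φ' (Set.Ioc a b) := by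
    intro a b ha
    refine MemLp.integrable (q := 2) (by norm_num) ?_
    refine (memLp_two_iff_integrable_sq hφ'meas.aestronglyMeasurable).2 ?_
    exact hφ'L2.mono_set fun x hx => ha.trans_lt hx.1
  have hterm : ∀ j, (φ (t j) - prevVal (fun i => φ (t i)) j) ^ 2 / (t j - prevVal t j) ≤
      ∫ s in Set.Ioc (prevVal t j) (t j), φ' s ^ 2 := by
    intro j
    have hlt := prevVal_lt hmono hpos j
    have h0 := prevVal_nonneg hpos j
    have hincr : φ (t j) - prevVal (fun i => φ (t i)) j
        = ∫ s in Set.Ioc (prevVal t j) (t j), φ' s := by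
      rw [← map_prevVal hφ0, hφrep _ (hpos j).le, hφrep _ h0, sub_eq_iff_eq_add',
        ← Set.Ioc_union_Ioc_eq_Ioc h0 hlt.le,
        setIntegral_union (Set.Ioc_disjoint_Ioc_of_le le_rfl) measurableSet_Ioc
          (hint _ _ le_rfl) (hint _ _ h0)]
    rw [hincr, div_le_iff₀ (sub_pos.2 hlt)]
    refine (sq_integral_le_mul_integral (hφ'L2.mono_set (hsub j))
      (integrable_const (1 : ℝ)) (hint _ _ h0) (fun _ => sq_nonneg _) (fun _ => zero_le_one)
      (fun _ => (mul_one _).ge)).trans_eq ?_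
    simp [hlt.le]
  refine (Finset.sum_le_sum fun j _ => hterm j).trans ?_
  rw [← integral_biUnion_finset Finset.univ (fun _ _ => measurableSet_Ioc) ?_
    (fun j _ => hφ'L2.mono_set (hsub j))]
  · exact setIntegral_mono_set hφ'L2 (Filter.Eventually.of_forall fun _ => sq_nonneg _)
      (Set.iUnion₂_subset fun j _ => hsub j).eventuallyLE
  · intro i _ j _ hij
    rcases lt_or_gt_of_ne hij with h | h
    · exact Set.Ioc_disjoint_Ioc_of_le (le_prevVal_of_lt hmono h)
    · exact (Set.Ioc_disjoint_Ioc_of_le (le_prevVal_of_lt hmono h)).symm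

lemma partialGrad_eq {n k : ℕ} {f : (Fin k → EuclideanSpace ℝ (Fin n)) → ℝ}
    (hf : Differentiable ℝ f) (j : Fin k) (y : Fin k → EuclideanSpace ℝ (Fin n)) :
    partialGrad n k f j y = (InnerProductSpace.toDual ℝ (EuclideanSpace ℝ (Fin n))).symm
      ((fderiv ℝ f y).comp (ContinuousLinearMap.single ℝ (fun _ => EuclideanSpace ℝ (Fin n)) j)) := by
  have h1 : HasFDerivAt (fun z => f (Function.update y j z))
      ((fderiv ℝ f y).comp (ContinuousLinearMap.single ℝ (fun _ => EuclideanSpace ℝ (Fin n)) j)) (y j) := by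
    refine HasFDerivAt.comp (y j) (g := f) ?_ ?_
    · rw [Function.update_eq_self]
      exact (hf y).hasFDerivAt
    · convert! hasFDerivAt_update (𝕜 := ℝ) (i := j) y (y j) using 1
      refine ContinuousLinearMap.ext fun v => funext fun i => ?_
      rcases eq_or_ne i j with rfl | hij
      · simp
      · simp [hij]
  rw [partialGrad, gradient, h1.fderiv]

/-- the differential (Li–Yau type) Harnack inequality on path space of `ℝⁿ`, for the
cylinder function `F(γ) = f(γ_{t₁},…,γ_{t_k})` and the test function `φ`. -/
theorem differential_harnack_euclidean_path_space
    (n k : ℕ) (hn : 1 ≤ n) (hk : 1 ≤ k)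
    (t : Fin k → ℝ) (hmono : StrictMono t) (hpos : ∀ j, 0 < t j)
    (f : (Fin k → EuclideanSpace ℝ (Fin n)) → ℝ)
    (hf : ContDiff ℝ 2 f) (hfpos : ∀ y, 0 < f y)
    (M : ℝ) (hbd : ∀ y, |f y| ≤ M ∧ ‖fderiv ℝ f y‖ ≤ M ∧ ‖iteratedFDeriv ℝ 2 f y‖ ≤ M)
    (φ φ' : ℝ → ℝ) (hφ'meas : Measurable φ')
    (hφ'L2 : IntegrableOn (fun s => φ' s ^ 2) (Set.Ioi (0 : ℝ)))
    (hφrep : ∀ s ≥ (0 : ℝ), φ s = ∫ r in Set.Ioc (0 : ℝ) s, φ' r) :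
    (∑ i : Fin k, ∑ j : Fin k, φ (t i) * φ (t j) *
        ∫ y, ∑ α : Fin n, partialHess n k f i j y
            (EuclideanSpace.single α (1 : ℝ)) (EuclideanSpace.single α (1 : ℝ))
          ∂(heatMeasure n k t)) /
      (∫ y, f y ∂(heatMeasure n k t))
    - ‖∑ j : Fin k, φ (t j) •
        (∫ y, partialGrad n k f j y ∂(heatMeasure n k t))‖ ^ 2 /
      (∫ y, f y ∂(heatMeasure n k t)) ^ 2
    + ((n : ℝ) / 2) * (∫ s in Set.Ioi (0 : ℝ), φ' s ^ 2) ≥ 0 := by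
  have ht := prevVal_lt hmono hpos
  have hρi := integrable_heatDensity n ht
  set μ := heatMeasure n k t
  have : IsFiniteMeasure μ := isFiniteMeasure_withDensity_ofReal hρi.2
  set I := ∫ y, f y ∂μ
  set A := ∑ j, (φ (t j) - prevVal (fun i => φ (t i)) j) ^ 2 / (t j - prevVal t j)
  have hAle : A ≤ ∫ s in Set.Ioi (0 : ℝ), φ' s ^ 2 :=
    sum_sq_increments_le hmono hpos hφ'meas hφ'L2 hφrep
  let e : Fin n → EuclideanSpace ℝ (Fin n) := fun α => EuclideanSpace.single α 1
  let w : Fin n → Fin k → EuclideanSpace ℝ (Fin n) := fun α j => φ (t j) • e α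
  have hw : ∀ α, w α = ∑ j, φ (t j) • Pi.single j (e α) := fun α => by
    have := Finset.univ_sum_single (w α)
    rw [← this]
    simp [w, Pi.single_smul']
  have hdir : ∀ α, 0 ≤ I * (∫ y, iteratedFDeriv ℝ 2 f y ![w α, w α] ∂μ)
      - (∫ y, fderiv ℝ f y (w α) ∂μ) ^ 2 + A / 2 * I ^ 2 := fun α =>
    directional_harnack (continuous_heatDensity n k t) (heatDensity_nonneg ht) hρi
      (heatDensity_sq t (fun i => φ (t i)) (e := e α) (by simp [e])) hf (fun y => (hfpos y).le) hbd
  have hf1 : Continuous (fderiv ℝ f) := hf.continuous_fderiv (by norm_num)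
  have hf2 : Continuous (iteratedFDeriv ℝ 2 f) := hf.continuous_iteratedFDeriv le_rfl
  have hhessint : ∀ i j v v', Integrable (fun y => partialHess n k f i j y v v') μ := by
    intro i j v v'
    refine Integrable.of_bound
      (by unfold partialHess; fun_prop : Continuous _).aestronglyMeasurable
      (M * ∏ l, ‖(![Pi.single i v, Pi.single j v'] : Fin 2 → Fin k → EuclideanSpace ℝ (Fin n)) l‖)
      (Filter.Eventually.of_forall fun y => ?_)
    exact ((iteratedFDeriv ℝ 2 f y).le_opNorm _).trans
      (mul_le_mul_of_nonneg_right (hbd y).2.2 (Finset.prod_nonneg fun _ _ => norm_nonneg _))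
  have hgradint : ∀ j, Integrable (partialGrad n k f j) μ := by
    intro j
    have hfun : partialGrad n k f j = fun y => (InnerProductSpace.toDual ℝ _).symm
        ((fderiv ℝ f y).comp (ContinuousLinearMap.single ℝ _ j)) :=
      funext (partialGrad_eq (hf.differentiable (by norm_num)) j)
    rw [hfun]
    refine Integrable.of_bound (by fun_prop : Continuous _).aestronglyMeasurable
      (M * ‖ContinuousLinearMap.single ℝ (fun _ : Fin k => EuclideanSpace ℝ (Fin n)) j‖)
      (Filter.Eventually.of_forall fun y => ?_)
    rw [LinearIsometryEquiv.norm_map]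
    exact (ContinuousLinearMap.opNorm_comp_le _ _).trans
      (mul_le_mul_of_nonneg_right (hbd y).2.1 (norm_nonneg _))
  have hhess : ∑ i, ∑ j, φ (t i) * φ (t j) * ∫ y, ∑ α, partialHess n k f i j y (e α) (e α) ∂μ
      = ∑ α, ∫ y, iteratedFDeriv ℝ 2 f y ![w α, w α] ∂μ := by
    have hpt : ∀ α y, iteratedFDeriv ℝ 2 f y ![w α, w α]
        = ∑ i, ∑ j, φ (t i) * φ (t j) * partialHess n k f i j y (e α) (e α) := by
      intro α y
      simp only [partialHess, iteratedFDeriv_two_apply, Matrix.cons_val_zero, Matrix.cons_val_one,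
        hw α, map_sum, map_smul, sum_apply, smul_apply,
        smul_eq_mul, Finset.mul_sum]
      rw [Finset.sum_comm]
      exact Finset.sum_congr rfl fun i _ => Finset.sum_congr rfl fun j _ => by ring
    have hα : ∀ α, ∫ y, iteratedFDeriv ℝ 2 f y ![w α, w α] ∂μ
        = ∑ i, ∑ j, φ (t i) * φ (t j) * ∫ y, partialHess n k f i j y (e α) (e α) ∂μ := by
      intro α
      simp only [hpt]
      rw [integral_finsetSum _ fun i _ => integrable_finsetSum _ fun j _ =>
        (hhessint i j _ _).const_mul _]
      refine Finset.sum_congr rfl fun i _ => ?_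
      rw [integral_finsetSum _ fun j _ => (hhessint i j _ _).const_mul _]
      simp only [integral_const_mul]
    simp only [hα]
    conv_rhs => rw [Finset.sum_comm]
    refine Finset.sum_congr rfl fun i _ => ?_
    conv_rhs => rw [Finset.sum_comm]
    refine Finset.sum_congr rfl fun j _ => ?_
    rw [integral_finsetSum _ fun α _ => hhessint i j _ _, Finset.mul_sum]
  have hgrad : ‖∑ j, φ (t j) • ∫ y, partialGrad n k f j y ∂μ‖ ^ 2
      = ∑ α, (∫ y, fderiv ℝ f y (w α) ∂μ) ^ 2 := by
    rw [EuclideanSpace.norm_sq_eq]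
    refine Finset.sum_congr rfl fun α _ => ?_
    rw [Real.norm_eq_abs, sq_abs]
    congr 1
    have hj : ∀ j, (∫ y, partialGrad n k f j y ∂μ) α
        = ∫ y, fderiv ℝ f y (Pi.single j (e α)) ∂μ := by
      intro j
      have hcoord := (EuclideanSpace.proj α : EuclideanSpace ℝ (Fin n) →L[ℝ] ℝ).integral_comp_comm
        (hgradint j)
      refine hcoord.symm.trans (integral_congr_ae (Filter.Eventually.of_forall fun y => ?_))
      have h1 : inner ℝ (partialGrad n k f j y) (e α) = fderiv ℝ f y (Pi.single j (e α)) := by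
        rw [partialGrad_eq (hf.differentiable (by norm_num)),
          InnerProductSpace.toDual_symm_apply]
        rfl
      simpa [e, EuclideanSpace.inner_single_right] using h1
    have hd : ∀ j, Integrable (fun y => fderiv ℝ f y (Pi.single j (e α))) μ := fun j =>
      Integrable.of_bound (by fun_prop : Continuous _).aestronglyMeasurable
        (M * ‖(Pi.single j (e α) : Fin k → EuclideanSpace ℝ (Fin n))‖)
        (Filter.Eventually.of_forall fun y => ((fderiv ℝ f y).le_opNorm _).trans
          (mul_le_mul_of_nonneg_right (hbd y).2.1 (norm_nonneg _)))
    simp only [hw α, map_sum, map_smul, smul_eq_mul]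
    rw [integral_finsetSum _ fun j _ => (hd j).const_mul _]
    simp [integral_const_mul, hj]
  have hE0 : 0 ≤ ∫ s in Set.Ioi (0 : ℝ), φ' s ^ 2 := integral_nonneg fun _ => sq_nonneg _
  change (∑ i, ∑ j, φ (t i) * φ (t j) * ∫ y, ∑ α, partialHess n k f i j y (e α) (e α) ∂μ) / I
    - _ + _ ≥ 0
  rw [hhess, hgrad]
  rcases eq_or_ne I 0 with hI0 | hI0
  · simp only [hI0, div_zero, sub_zero, zero_add, zero_pow two_ne_zero]
    positivity
  have hsum := Finset.sum_nonneg fun α (_ : α ∈ Finset.univ) => hdir α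
  rw [Finset.sum_add_distrib, Finset.sum_sub_distrib, ← Finset.mul_sum] at hsum
  simp only [Finset.sum_const, Finset.card_univ, Fintype.card_fin, nsmul_eq_mul] at hsum
  set H := ∑ α, ∫ y, iteratedFDeriv ℝ 2 f y ![w α, w α] ∂μ
  set G := ∑ α, (∫ y, fderiv ℝ f y (w α) ∂μ) ^ 2
  have hdiv : 0 ≤ H / I - G / I ^ 2 + (n : ℝ) / 2 * A := by
    have : H / I - G / I ^ 2 + (n : ℝ) / 2 * A = (I * H - G + n * (A / 2 * I ^ 2)) / I ^ 2 := by
      field_simp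
    rw [this]
    positivity
  have hmul : (n : ℝ) / 2 * A ≤ n / 2 * ∫ s in Set.Ioi (0 : ℝ), φ' s ^ 2 := by gcongr
  linarith
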